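/- Let R be a commutative ring and let (a_n)_{n\ge 1}, (b_n)_{n\ge 1}, (c_n)_{n\ge 1}, (d_n)_{n\ge 1} be sequences in R. Set A = 1 + \sum_{n\ge 1} a_n Q^n, B = 1 + \sum_{n\ge 1} b_n Q^n, C = 1 + \sum_{n\ge 1} c_n Q^n, D = 1 + \sum_{n\ge 1} d_n Q^n in the formal power series ring R[[Q]]. Then the identity C\cdot D = A\cdot B holds in R[[Q]] if and only if for every n \ge 1 one has c_n = \sum_{l=1}^{n+1} (-1)^{l-1} \sum_{((i_1,j_1),\dots,(i_l,j_l)) \in S_l(n)} a_{i_l}\, d_{i_1-i_2}\, d_{i_2-i_3} \cdots d_{i_{l-1}-i_l}\, b_{j_1}, where by convention a_0 = b_0 = 1. -/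

import Mathlib

open PowerSeries Finset

/-- The set `S_l(n)` of tuples `((i_1,j_1),...,(i_l,j_l))` of pairs of nonnegative
integers with `i_1 > i_2 > ... > i_l` and `i_k + j_k = n` for all `k`.
(Any such pair automatically satisfies `i_k, j_k ≤ n`, so no generality is lost
by cutting off at `n`.) -/
def Sln (l n : ℕ) : Finset (Fin l → ℕ × ℕ) :=
  (Fintype.piFinset fun _ => Finset.range (n + 1) ×ˢ Finset.range (n + 1)).filter
    (fun f => (∀ k : Fin l, (f k).1 + (f k).2 = n) ∧
      ∀ k k' : Fin l, k < k' → (f k').1 < (f k).1)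

/-- The inclusion-exclusion sum
`∑_{l=1}^{n+1} (-1)^{l-1} ∑_{S_l(n)} a_{i_l} d_{i_1-i_2} ⋯ d_{i_{l-1}-i_l} b_{j_1}`,
written with `l = l' + 1`, `l' ∈ {0, ..., n}`. -/
def incExcSum {R : Type*} [CommRing R] (a b d : ℕ → R) (n : ℕ) : R :=
  ∑ l ∈ Finset.range (n + 1), (-1 : R) ^ l *
    ∑ f ∈ Sln (l + 1) n,
      a (f (Fin.last l)).1 *
        (∏ k : Fin l, d ((f (Fin.castSucc k)).1 - (f (Fin.succ k)).1)) *
        b (f 0).2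

theorem mem_Sln_iff (l n : ℕ) (f : Fin l → ℕ × ℕ) :
    f ∈ Sln l n ↔ (∀ k : Fin l, (f k).1 + (f k).2 = n) ∧
      ∀ k k' : Fin l, k < k' → (f k').1 < (f k).1 := by
  unfold Sln
  simp only [Finset.mem_filter, Fintype.mem_piFinset, Finset.mem_product, Finset.mem_range]
  constructor
  · exact fun h => h.2
  · intro h
    refine ⟨fun k => ?_, h⟩
    have := h.1 k
    omega

theorem inner_sum_eq {R : Type*} [CommRing R] (a d : ℕ → R) (hd : d 0 = 1) (n l : ℕ) :
    ∀ b : ℕ → R, ∑ f ∈ Sln (l + 1) n,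
      a (f (Fin.last l)).1 *
        (∏ k : Fin l, d ((f (Fin.castSucc k)).1 - (f (Fin.succ k)).1)) *
        b (f 0).2 =
      coeff n (PowerSeries.mk a * (PowerSeries.mk d - 1) ^ l * PowerSeries.mk b) := by
  induction l with
  | zero =>
    intro b
    rw [pow_zero, mul_one, PowerSeries.coeff_mul]
    refine Finset.sum_bij' (fun f _ => f 0) (fun p _ => fun _ => p) ?_ ?_ ?_ ?_ ?_
    · intro f hf
      rw [mem_Sln_iff] at hf
      simpa using hf.1 0
    · intro p hp
      rw [mem_Sln_iff]
      refine ⟨fun k => by simpa using hp, fun k k' h => ?_⟩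
      omega
    · intro f hf
      funext k
      rw [show k = 0 from Fin.ext (by simp)]
    · intro p hp
      rfl
    · intro f hf
      simp
  | succ l ih =>
    intro b
    have key := ih (fun m => coeff m ((PowerSeries.mk d - 1) * PowerSeries.mk b))
    have hmk : PowerSeries.mk (fun m => coeff m ((PowerSeries.mk d - 1) * PowerSeries.mk b))
        = (PowerSeries.mk d - 1) * PowerSeries.mk b := by
      ext m; simp
    rw [hmk] at key
    rw [show PowerSeries.mk a * (PowerSeries.mk d - 1) ^ (l + 1) * PowerSeries.mk b =
      PowerSeries.mk a * (PowerSeries.mk d - 1) ^ l *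
        ((PowerSeries.mk d - 1) * PowerSeries.mk b) by ring, ← key]
    have hco : ∀ m, coeff m ((PowerSeries.mk d - 1) * PowerSeries.mk b) =
        ∑ p ∈ (HasAntidiagonal.antidiagonal m).filter (fun p => p.1 ≠ 0), d p.1 * b p.2 := by
      intro m
      rw [PowerSeries.coeff_mul, Finset.sum_filter]
      refine Finset.sum_congr rfl fun p _ => ?_
      by_cases h : p.1 = 0
      · simp [h, hd]
      · simp [h, PowerSeries.coeff_one]
    simp only [hco, Finset.mul_sum]
    rw [Finset.sum_sigma']
    refine Finset.sum_bij'
      (fun f _ => ⟨fun k => f (Fin.succ k), ((f 0).1 - (f 1).1, (f 0).2)⟩)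
      (fun x _ => Fin.cons ((x.1 0).1 + x.2.1, x.2.2) x.1) ?_ ?_ ?_ ?_ ?_
    · intro f hf
      rw [mem_Sln_iff] at hf
      have h0 := hf.1 0
      have h1 := hf.1 1
      have h2 := hf.2 0 1 (by simp)
      simp only [Finset.mem_sigma, mem_Sln_iff, Finset.mem_filter, HasAntidiagonal.mem_antidiagonal]
      refine ⟨⟨fun k => hf.1 _, fun k k' h => hf.2 _ _ (by simpa using h)⟩, ?_, ?_⟩
      · rw [Fin.succ_zero_eq_one]; omega
      · omega
    · rintro ⟨g, p⟩ hx
      simp only [Finset.mem_sigma, mem_Sln_iff, Finset.mem_filter, HasAntidiagonal.mem_antidiagonal] at hx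
      obtain ⟨⟨h1, h2⟩, h3, h4⟩ := hx
      rw [mem_Sln_iff]
      have h10 := h1 0
      constructor
      · intro k
        refine Fin.cases ?_ (fun k => ?_) k
        · simp only [Fin.cons_zero]; omega
        · simpa using h1 k
      · intro k k'
        refine Fin.cases ?_ (fun k' => ?_) k'
        · intro h; exact absurd h (by simp)
        · refine Fin.cases ?_ (fun k => ?_) k
          · intro _
            simp only [Fin.cons_zero, Fin.cons_succ]
            rcases Fin.eq_zero_or_eq_succ k' with h | ⟨j, h⟩
            · subst h; omega
            · have := h2 0 k' (by subst h; exact Fin.succ_pos j)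
              omega
          · intro h
            simpa using h2 k k' (by simpa using h)
    · intro f hf
      rw [mem_Sln_iff] at hf
      have h2 := hf.2 0 1 (by simp)
      funext k
      refine Fin.cases ?_ (fun k => ?_) k
      · simp only [Fin.cons_zero, Fin.succ_zero_eq_one]
        ext
        · simp only; omega
        · rfl
      · simp
    · rintro ⟨g, p⟩ hx
      have e : (Fin.cons ((g 0).1 + p.1, p.2) g : Fin (l + 1 + 1) → ℕ × ℕ) 1 = g 0 := by
        rw [← Fin.succ_zero_eq_one, Fin.cons_succ]
      simp [e]
    · intro f hf
      rw [Fin.prod_univ_succ]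
      simp only [Fin.castSucc_zero, Fin.succ_zero_eq_one, Fin.succ_last, Fin.succ_castSucc]
      ring

theorem coeff_mul_pow_zero {R : Type*} [CommRing R] (d : ℕ → R) (hd : d 0 = 1)
    (F : PowerSeries R) (m l : ℕ) (h : m < l) :
    coeff m (F * (-(PowerSeries.mk d - 1)) ^ l) = 0 := by
  have hX : (X : PowerSeries R) ∣ -(PowerSeries.mk d - 1) := by
    rw [PowerSeries.X_dvd_iff]
    simp [hd]
  have h2 : (X : PowerSeries R) ^ l ∣ F * (-(PowerSeries.mk d - 1)) ^ l :=
    Dvd.dvd.mul_left (pow_dvd_pow_of_dvd hX l) F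
  exact PowerSeries.X_pow_dvd_iff.1 h2 m h

theorem incExcSum_eq {R : Type*} [CommRing R] (a b d : ℕ → R) (hd : d 0 = 1) (m N : ℕ)
    (h : m + 1 ≤ N) :
    incExcSum a b d m = coeff m (PowerSeries.mk a * PowerSeries.mk b *
      ∑ l ∈ Finset.range N, (-(PowerSeries.mk d - 1)) ^ l) := by
  rw [Finset.mul_sum, map_sum]
  unfold incExcSum
  rw [← Finset.sum_subset (Finset.range_subset_range.2 h)]
  · refine Finset.sum_congr rfl fun l _ => ?_
    rw [inner_sum_eq a d hd]
    rw [neg_pow (PowerSeries.mk d - 1), show PowerSeries.mk a * PowerSeries.mk b *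
      ((-1) ^ l * (PowerSeries.mk d - 1) ^ l) = C ((-1 : R) ^ l) *
      (PowerSeries.mk a * (PowerSeries.mk d - 1) ^ l * PowerSeries.mk b) by
        rw [map_pow, map_neg, map_one]; ring, PowerSeries.coeff_C_mul]
  · intro l _ hl
    apply coeff_mul_pow_zero d hd
    simp at hl
    omega

theorem mk_incExcSum_mul {R : Type*} [CommRing R] (a b d : ℕ → R) (hd : d 0 = 1) :
    PowerSeries.mk (incExcSum a b d) * PowerSeries.mk d =
      PowerSeries.mk a * PowerSeries.mk b := by
  ext n
  have h1 : coeff n (PowerSeries.mk (incExcSum a b d) * PowerSeries.mk d) =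
      coeff n ((PowerSeries.mk a * PowerSeries.mk b *
      ∑ l ∈ Finset.range (n + 1), (-(PowerSeries.mk d - 1)) ^ l) * PowerSeries.mk d) := by
    rw [PowerSeries.coeff_mul, PowerSeries.coeff_mul]
    refine Finset.sum_congr rfl fun p hp => ?_
    rw [HasAntidiagonal.mem_antidiagonal] at hp
    rw [PowerSeries.coeff_mk, incExcSum_eq a b d hd p.1 (n + 1) (by omega)]
  have h2 := geom_sum_mul_neg (-(PowerSeries.mk d - 1)) (n + 1)
  rw [show (1 : PowerSeries R) - -(PowerSeries.mk d - 1) = PowerSeries.mk d by ring] at h2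
  rw [h1, mul_assoc, h2, mul_sub, mul_one, map_sub,
    coeff_mul_pow_zero d hd _ n (n + 1) (by omega), sub_zero]

theorem inclusion_exclusion_coefficients {R : Type*} [CommRing R]
    (a b c d : ℕ → R) (ha : a 0 = 1) (hb : b 0 = 1) (hc : c 0 = 1) (hd : d 0 = 1) :
    PowerSeries.mk c * PowerSeries.mk d = PowerSeries.mk a * PowerSeries.mk b ↔
      ∀ n : ℕ, 1 ≤ n → c n = incExcSum a b d n := by
  have hu : IsUnit (PowerSeries.mk d) := by
    rw [PowerSeries.isUnit_iff_constantCoeff]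
    simp [hd]
  rw [← mk_incExcSum_mul a b d hd, hu.mul_left_inj]
  constructor
  · intro h n _
    have := congrArg (coeff n) h
    simpa using this
  · intro h
    ext n
    rw [PowerSeries.coeff_mk, PowerSeries.coeff_mk]
    rcases Nat.eq_zero_or_pos n with rfl | hn
    · rw [incExcSum_eq a b d hd 0 1 le_rfl]
      simp [ha, hb, hc]
    · exact h n hn
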